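/- In an optimal policy, by the end of the transmission period at least one of the two nodes has consumed all of its energy: if r* is an optimal rate policy, then ∑_{i=1}^N f(r*_i) = ∑_{i=1}^N E_i or ∑_{i=1}^N φ(r*_i) = ∑_{i=1}^N Ē_i. -/

import Mathlib

open Finset

/-- A rate policy `r` is feasible for the single-user energy harvesting channel with
transmitter energies `E`, receiver energies `Ebar`, rate-to-power function `f`,
and decoding cost function `φ`, over slots `1,…,N`. -/
def SUFeasible (N : ℕ) (E Ebar : ℕ → ℝ) (f φ : ℝ → ℝ) (r : ℕ → ℝ) : Prop :=
  (∀ i ∈ Finset.Icc 1 N, 0 ≤ r i) ∧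
  (∀ k ∈ Finset.Icc 1 N,
      ∑ i ∈ Finset.Icc 1 k, f (r i) ≤ ∑ i ∈ Finset.Icc 1 k, E i) ∧
  (∀ k ∈ Finset.Icc 1 N,
      ∑ i ∈ Finset.Icc 1 k, φ (r i) ≤ ∑ i ∈ Finset.Icc 1 k, Ebar i)

theorem eh_slack {g : ℝ → ℝ} (hg : ContinuousOn g (Set.Ici 0)) {x : ℝ} (hx : 0 ≤ x)
    {e : ℝ} (he : 0 < e) :
    ∃ d : ℝ, 0 < d ∧ ∀ t : ℝ, 0 ≤ t → t ≤ d → g (x + t) < g x + e := by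
  obtain ⟨d, hd, H⟩ := Metric.continuousOn_iff.1 hg x hx e he
  refine ⟨d / 2, by linarith, fun t ht htd => ?_⟩
  have := H (x + t) (Set.mem_Ici.2 (by linarith)) (by
    rw [Real.dist_eq, add_sub_cancel_left, abs_of_nonneg ht]; linarith)
  rw [Real.dist_eq] at this
  linarith [(abs_lt.1 this).2]

theorem eh_sum_before (g : ℝ → ℝ) (r : ℕ → ℝ) (N k : ℕ) (hk : k < N) {y : ℝ} :
    ∑ i ∈ Finset.Icc 1 k, g (Function.update r N y i) = ∑ i ∈ Finset.Icc 1 k, g (r i) := by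
  refine Finset.sum_congr rfl fun i hi => ?_
  have := (Finset.mem_Icc.1 hi).2
  rw [Function.update_of_ne (by omega)]

theorem eh_sum_last (g : ℝ → ℝ) (r : ℕ → ℝ) (N : ℕ) (hN : 1 ≤ N) (y : ℝ) :
    ∑ i ∈ Finset.Icc 1 N, g (Function.update r N y i)
      = ∑ i ∈ Finset.Icc 1 N, g (r i) - g (r N) + g y := by
  obtain ⟨m, rfl⟩ : ∃ m, N = m + 1 := ⟨N - 1, by omega⟩
  rw [Finset.sum_Icc_succ_top (by omega), Finset.sum_Icc_succ_top (by omega),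
    eh_sum_before g r (m + 1) m (by omega), Function.update_self]
  ring

/-- in an optimal policy, by the deadline `N` the transmitter has used all
of its energy in transmission or the receiver has used all of its energy in decoding. -/
theorem optimal_policy_energy_exhausted_at_deadline
    (N : ℕ) (hN : 1 ≤ N)
    (E Ebar : ℕ → ℝ)
    (hE : ∀ i ∈ Finset.Icc 1 N, 0 ≤ E i)
    (hEbar : ∀ i ∈ Finset.Icc 1 N, 0 ≤ Ebar i)
    (f φ : ℝ → ℝ)
    (hf_cont : ContinuousOn f (Set.Ici 0))
    (hf_mono : StrictMonoOn f (Set.Ici 0))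
    (hf_conv : StrictConvexOn ℝ (Set.Ici 0) f)
    (hf_nonneg : ∀ x : ℝ, 0 ≤ x → 0 ≤ f x)
    (hf0 : f 0 = 0)
    (hphi_cont : ContinuousOn φ (Set.Ici 0))
    (hphi_mono : StrictMonoOn φ (Set.Ici 0))
    (hphi_conv : StrictConvexOn ℝ (Set.Ici 0) φ)
    (hphi_nonneg : ∀ x : ℝ, 0 ≤ x → 0 ≤ φ x)
    (hphi0 : φ 0 = 0)
    (r : ℕ → ℝ)
    (hfeas : SUFeasible N E Ebar f φ r)
    (hopt : ∀ r' : ℕ → ℝ, SUFeasible N E Ebar f φ r' →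
      ∑ i ∈ Finset.Icc 1 N, r' i ≤ ∑ i ∈ Finset.Icc 1 N, r i) :
    (∑ i ∈ Finset.Icc 1 N, f (r i) = ∑ i ∈ Finset.Icc 1 N, E i) ∨
    (∑ i ∈ Finset.Icc 1 N, φ (r i) = ∑ i ∈ Finset.Icc 1 N, Ebar i) := by
  by_contra hcon
  push Not at hcon
  obtain ⟨h1, h2⟩ := hcon
  obtain ⟨hr, hF, hP⟩ := hfeas
  have hNm : N ∈ Finset.Icc 1 N := Finset.mem_Icc.2 ⟨hN, le_rfl⟩
  obtain ⟨d1, hd1, H1⟩ := eh_slack hf_cont (hr N hNm) (sub_pos.2 (lt_of_le_of_ne (hF N hNm) h1))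
  obtain ⟨d2, hd2, H2⟩ := eh_slack hphi_cont (hr N hNm) (sub_pos.2 (lt_of_le_of_ne (hP N hNm) h2))
  have hd : 0 < min d1 d2 := lt_min hd1 hd2
  have K1 := H1 (min d1 d2) hd.le (min_le_left _ _)
  have K2 := H2 (min d1 d2) hd.le (min_le_right _ _)
  have key := hopt (Function.update r N (r N + min d1 d2)) ⟨?_, ?_, ?_⟩
  · have := eh_sum_last id r N hN (r N + min d1 d2)
    simp only [id] at this
    linarith
  · intro i hi
    by_cases h : i = N
    · subst h
      rw [Function.update_self]
      linarith [hr i hi]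
    · rw [Function.update_of_ne h]
      exact hr i hi
  · intro k hk
    by_cases h : k = N
    · subst h
      rw [eh_sum_last f r k hN]
      linarith
    · rw [eh_sum_before f r N k (lt_of_le_of_ne (Finset.mem_Icc.1 hk).2 h)]
      exact hF k hk
  · intro k hk
    by_cases h : k = N
    · subst h
      rw [eh_sum_last φ r k hN]
      linarith
    · rw [eh_sum_before φ r N k (lt_of_le_of_ne (Finset.mem_Icc.1 hk).2 h)]
      exact hP k hk
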